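/- Let d ≥ 1, R > 0, B_W ≥ 0, let w ∈ ℝ^d with w ≠ 0 and ‖w‖₁ ≤ B_W, and let r ∈ ℝ^d satisfy, for every i, r_i ≥ R/(2d) and r_i ≥ R·|w_i|/(2‖w‖₁). Let N = (N_1,…,N_d) be a random vector with independent coordinates, each N_i Gaussian with mean 0 and variance 1/r_i. Then: (a) Σ_{i=1}^d w_i²/r_i² ≤ 4·d·B_W²/R²; (b) 𝔼[⟨w, N⟩²] = Σ_{i=1}^d w_i²/r_i ≤ 2·B_W²/R; (c) 𝔼[‖N‖₂²] = Σ_{i=1}^d 1/r_i ≤ 2·d²/R; (d) 𝔼[ ⟨w, N⟩² · ‖N‖₂² ] ≤ 12·(d/R²)·B_W² + 4·(d²/R²)·B_W². -/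

import Mathlib

open MeasureTheory ProbabilityTheory

/-- The fourth moment of a centered real Gaussian. -/
lemma integral_pow_four_gaussianReal (v : NNReal) :
    ∫ x, x ^ 4 ∂gaussianReal 0 v = 3 * (v : ℝ) ^ 2 := by
  have key (p p' q : ℝ → ℝ) (hp : ∀ t, HasDerivAt p (p' t) t)
      (hq : ∀ t, p' t + p t * (v * t) = q t) :
      deriv (fun t ↦ p t * Real.exp (v * t ^ 2 / 2)) =
        fun t ↦ q t * Real.exp (v * t ^ 2 / 2) := by
    ext t
    have he : HasDerivAt (fun t : ℝ ↦ (v : ℝ) * t ^ 2 / 2) (v * t) t :=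
      (((hasDerivAt_pow 2 t).const_mul (v : ℝ)).div_const 2).congr_deriv (by norm_num; ring)
    rw [((hp t).fun_mul he.exp).deriv, ← hq]
    ring
  have h0 : mgf (fun x ↦ x) (gaussianReal 0 v) =
      fun t : ℝ ↦ 1 * Real.exp (v * t ^ 2 / 2) := by
    rw [mgf_fun_id_gaussianReal]
    simp
  have h1 := key (fun _ ↦ 1) (fun _ ↦ 0) (fun t ↦ v * t) (fun t ↦ hasDerivAt_const t 1)
    (fun t ↦ by ring)
  have h2 := key (fun t ↦ v * t) (fun _ ↦ v) (fun t ↦ v + v ^ 2 * t ^ 2)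
    (fun t ↦ hasDerivAt_const_mul (v : ℝ)) (fun t ↦ by ring)
  have h3 := key (fun t ↦ v + v ^ 2 * t ^ 2) (fun t ↦ 2 * v ^ 2 * t)
    (fun t ↦ 3 * v ^ 2 * t + v ^ 3 * t ^ 3)
    (fun t ↦ (((hasDerivAt_pow 2 t).const_mul ((v : ℝ) ^ 2)).const_add (v : ℝ)).congr_deriv
      (by norm_num; ring))
    (fun t ↦ by ring)
  have h4 := key (fun t ↦ 3 * v ^ 2 * t + v ^ 3 * t ^ 3) (fun t ↦ 3 * v ^ 2 + 3 * v ^ 3 * t ^ 2)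
    (fun t ↦ 3 * v ^ 2 + 6 * v ^ 3 * t ^ 2 + v ^ 4 * t ^ 4)
    (fun t ↦ ((hasDerivAt_const_mul (3 * (v : ℝ) ^ 2)).fun_add
      ((hasDerivAt_pow 3 t).const_mul ((v : ℝ) ^ 3))).congr_deriv (by norm_num; ring))
    (fun t ↦ by ring)
  calc ∫ x, x ^ 4 ∂gaussianReal 0 v
    _ = iteratedDeriv 4 (mgf (fun x ↦ x) (gaussianReal 0 v)) 0 := by
      rw [iteratedDeriv_mgf_zero] <;> simp
    _ = 3 * (v : ℝ) ^ 2 := by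
      rw [h0, iteratedDeriv_eq_iterate]
      simp only [Function.iterate_succ, Function.iterate_zero, Function.comp_apply, id_eq]
      rw [h1, h2, h3, h4]
      simp

section GaussianNoise

variable {Ω : Type*} [MeasurableSpace Ω] {μ : Measure Ω}

lemma memLp_of_map_eq_gaussianReal {X : Ω → ℝ} {m : ℝ} {v : NNReal} (hX : AEMeasurable X μ)
    (hlaw : μ.map X = gaussianReal m v) (p : NNReal) : MemLp X p μ := by
  have h := memLp_id_gaussianReal (μ := m) (v := v) p
  rw [← hlaw] at h
  exact (memLp_map_measure_iff aestronglyMeasurable_id hX).1 h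

lemma integral_of_map_eq_gaussianReal {X : Ω → ℝ} {m : ℝ} {v : NNReal} (hX : AEMeasurable X μ)
    (hlaw : μ.map X = gaussianReal m v) : ∫ ω, X ω ∂μ = m := by
  rw [← integral_id_gaussianReal (μ := m) (v := v), ← hlaw, integral_map hX (by fun_prop)]

lemma integral_sq_of_map_eq_gaussianReal {X : Ω → ℝ} {v : NNReal} (hX : AEMeasurable X μ)
    (hlaw : μ.map X = gaussianReal 0 v) : ∫ ω, X ω ^ 2 ∂μ = v := by
  rw [← variance_fun_id_gaussianReal (μ := 0) (v := v),
    variance_of_integral_eq_zero (by fun_prop) integral_id_gaussianReal, ← hlaw,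
    integral_map hX (by fun_prop)]

lemma integral_pow_four_of_map_eq_gaussianReal {X : Ω → ℝ} {v : NNReal} (hX : AEMeasurable X μ)
    (hlaw : μ.map X = gaussianReal 0 v) : ∫ ω, X ω ^ 4 ∂μ = 3 * (v : ℝ) ^ 2 := by
  rw [← integral_pow_four_gaussianReal, ← hlaw, integral_map hX (by fun_prop)]

/-- Mixed fourth moment of `c X + T` and `X`, for a centered Gaussian `X` independent of a
centered square-integrable `T`. -/
lemma integral_sq_mul_sq_of_indepFun [IsProbabilityMeasure μ] {X T : Ω → ℝ} {v : NNReal}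
    (c : ℝ) (hX : AEMeasurable X μ)
    (hlaw : μ.map X = gaussianReal 0 v) (hT : MemLp T 2 μ) (hT0 : ∫ ω, T ω ∂μ = 0)
    (hXT : IndepFun X T μ) :
    Integrable (fun ω ↦ (c * X ω + T ω) ^ 2 * X ω ^ 2) μ ∧
      ∫ ω, (c * X ω + T ω) ^ 2 * X ω ^ 2 ∂μ = 3 * c ^ 2 * v ^ 2 + v * ∫ ω, T ω ^ 2 ∂μ := by
  have hpow (n : ℕ) : Integrable (fun ω ↦ X ω ^ n) μ := by
    have := (memLp_of_map_eq_gaussianReal hX hlaw n).integrable_norm_pow'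
    refine (integrable_norm_iff (hX.pow_const n).aestronglyMeasurable).1 ?_
    simpa [norm_pow] using this
  have hind3 : IndepFun (fun ω ↦ X ω ^ 3) T μ :=
    hXT.comp (φ := fun x ↦ x ^ 3) (ψ := id) (by fun_prop) measurable_id
  have hind2 : IndepFun (fun ω ↦ X ω ^ 2) (fun ω ↦ T ω ^ 2) μ :=
    hXT.comp (φ := fun x ↦ x ^ 2) (ψ := fun x ↦ x ^ 2) (by fun_prop) (by fun_prop)
  have i1 : Integrable (fun ω ↦ c ^ 2 * X ω ^ 4) μ := (hpow 4).const_mul _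
  have i2 : Integrable (fun ω ↦ 2 * c * (X ω ^ 3 * T ω)) μ :=
    (hind3.integrable_mul (hpow 3) (hT.integrable one_le_two)).const_mul _
  have i3 : Integrable (fun ω ↦ X ω ^ 2 * T ω ^ 2) μ :=
    hind2.integrable_mul (hpow 2) hT.integrable_sq
  have hexp : (fun ω ↦ (c * X ω + T ω) ^ 2 * X ω ^ 2) =
      fun ω ↦ c ^ 2 * X ω ^ 4 + 2 * c * (X ω ^ 3 * T ω) + X ω ^ 2 * T ω ^ 2 := by
    ext ω
    ring
  rw [hexp]
  refine ⟨(i1.add i2).add i3, ?_⟩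
  rw [integral_add (i1.fun_add i2) i3, integral_add i1 i2, integral_const_mul, integral_const_mul,
    hind3.integral_fun_mul_eq_mul_integral (hpow 3).1 hT.1,
    hind2.integral_fun_mul_eq_mul_integral (hpow 2).1 hT.integrable_sq.1, hT0,
    integral_pow_four_of_map_eq_gaussianReal hX hlaw, integral_sq_of_map_eq_gaussianReal hX hlaw]
  ring

variable {ι : Type*} {X : ι → Ω → ℝ} {v : ι → NNReal}

lemma memLp_sum_mul_gaussian (hX : ∀ i, Measurable (X i))
    (hlaw : ∀ i, μ.map (X i) = gaussianReal 0 (v i)) (w : ι → ℝ) (s : Finset ι) :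
    MemLp (fun ω ↦ ∑ i ∈ s, w i * X i ω) 2 μ :=
  memLp_finsetSum s fun i _ ↦
    (memLp_of_map_eq_gaussianReal (hX i).aemeasurable (hlaw i) 2).const_mul (w i)

lemma integral_sum_mul_gaussian [IsProbabilityMeasure μ] (hX : ∀ i, Measurable (X i))
    (hlaw : ∀ i, μ.map (X i) = gaussianReal 0 (v i)) (w : ι → ℝ) (s : Finset ι) :
    ∫ ω, ∑ i ∈ s, w i * X i ω ∂μ = 0 := by
  rw [integral_finsetSum]
  · simp [integral_const_mul, fun i ↦
      integral_of_map_eq_gaussianReal (hX i).aemeasurable (hlaw i)]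
  · exact fun i _ ↦ ((memLp_of_map_eq_gaussianReal (hX i).aemeasurable (hlaw i) 1).integrable
      (by simp)).const_mul (w i)

lemma integral_sum_mul_gaussian_sq [IsProbabilityMeasure μ] (hX : ∀ i, Measurable (X i))
    (hindep : iIndepFun X μ) (hlaw : ∀ i, μ.map (X i) = gaussianReal 0 (v i)) (w : ι → ℝ)
    (s : Finset ι) :
    ∫ ω, (∑ i ∈ s, w i * X i ω) ^ 2 ∂μ = ∑ i ∈ s, w i ^ 2 * v i := by
  have hvar := IndepFun.variance_sum (μ := μ) (X := fun i ω ↦ w i * X i ω) (s := s)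
    (fun i _ ↦ (memLp_of_map_eq_gaussianReal (hX i).aemeasurable (hlaw i) 2).const_mul (w i))
    (fun i _ j _ hij ↦ (hindep.indepFun hij).comp (φ := fun x ↦ w i * x) (ψ := fun x ↦ w j * x)
      (by fun_prop) (by fun_prop))
  have hsum : (∑ i ∈ s, fun ω ↦ w i * X i ω) = fun ω ↦ ∑ i ∈ s, w i * X i ω := by
    ext ω
    simp
  rw [hsum, variance_of_integral_eq_zero (memLp_sum_mul_gaussian hX hlaw w s).1.aemeasurable
    (integral_sum_mul_gaussian hX hlaw w s)] at hvar
  rw [hvar]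
  refine Finset.sum_congr rfl fun i _ ↦ ?_
  rw [variance_const_mul, variance_of_integral_eq_zero (hX i).aemeasurable
    (integral_of_map_eq_gaussianReal (hX i).aemeasurable (hlaw i)),
    integral_sq_of_map_eq_gaussianReal (hX i).aemeasurable (hlaw i)]

variable [Fintype ι]

lemma integral_sum_gaussian_sq (hX : ∀ i, Measurable (X i))
    (hlaw : ∀ i, μ.map (X i) = gaussianReal 0 (v i)) :
    ∫ ω, ∑ i, X i ω ^ 2 ∂μ = ∑ i, (v i : ℝ) := by
  rw [integral_finsetSum]
  · exact Finset.sum_congr rfl fun i _ ↦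
      integral_sq_of_map_eq_gaussianReal (hX i).aemeasurable (hlaw i)
  · exact fun i _ ↦
      (memLp_of_map_eq_gaussianReal (hX i).aemeasurable (hlaw i) 2).integrable_sq

/-- The exact value of `𝔼[⟨w, X⟩² ‖X‖²]` for independent centered Gaussian coordinates. -/
lemma integral_sum_mul_gaussian_sq_mul_sum_sq [IsProbabilityMeasure μ] (hX : ∀ i, Measurable (X i))
    (hindep : iIndepFun X μ) (hlaw : ∀ i, μ.map (X i) = gaussianReal 0 (v i)) (w : ι → ℝ) :
    ∫ ω, (∑ i, w i * X i ω) ^ 2 * ∑ i, X i ω ^ 2 ∂μ =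
      2 * ∑ i, w i ^ 2 * v i ^ 2 + (∑ i, w i ^ 2 * v i) * ∑ i, (v i : ℝ) := by
  classical
  have hsplit (j : ι) (f : ι → ℝ) : ∑ i, f i = f j + ∑ i ∈ Finset.univ.erase j, f i :=
    (Finset.add_sum_erase _ f (Finset.mem_univ j)).symm
  have hj (j : ι) : Integrable (fun ω ↦ (∑ i, w i * X i ω) ^ 2 * X j ω ^ 2) μ ∧
      ∫ ω, (∑ i, w i * X i ω) ^ 2 * X j ω ^ 2 ∂μ =
        2 * (w j ^ 2 * v j ^ 2) + (∑ i, w i ^ 2 * v i) * v j := by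
    have hind : IndepFun (X j) (fun ω ↦ ∑ i ∈ Finset.univ.erase j, w i * X i ω) μ := by
      have hφ : Measurable fun x : ({j} : Finset ι) → ℝ ↦ x ⟨j, by simp⟩ := by fun_prop
      have hψ : Measurable fun x : Finset.univ.erase j → ℝ ↦
          ∑ i : Finset.univ.erase j, w i * x i := by fun_prop
      have h := (hindep.indepFun_finset {j} (Finset.univ.erase j) (by simp) hX).comp hφ hψ
      convert h using 1
      · rfl
      ext ω
      exact (Finset.sum_coe_sort (Finset.univ.erase j) (fun i ↦ w i * X i ω)).symm
    obtain ⟨hint, heq⟩ := integral_sq_mul_sq_of_indepFun (w j) (hX j).aemeasurable (hlaw j)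
      (memLp_sum_mul_gaussian hX hlaw w _) (integral_sum_mul_gaussian hX hlaw w _) hind
    have hsum (ω : Ω) : w j * X j ω + ∑ i ∈ Finset.univ.erase j, w i * X i ω = ∑ i, w i * X i ω :=
      (hsplit j fun i ↦ w i * X i ω).symm
    simp only [hsum] at hint heq
    refine ⟨hint, ?_⟩
    rw [heq, integral_sum_mul_gaussian_sq hX hindep hlaw, hsplit j (fun i ↦ w i ^ 2 * (v i : ℝ))]
    ring
  simp_rw [Finset.mul_sum]
  rw [integral_finsetSum _ fun j _ ↦ (hj j).1, ← Finset.sum_add_distrib]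
  exact Finset.sum_congr rfl fun j _ ↦ (hj j).2

end GaussianNoise

/-- **Moment bounds for the efficient allocation (proof of Theorem 9).**
Under the efficient allocation, `r_i ≥ R/(2d)` and `r_i ≥ R|w_i|/(2‖w‖₁)`, the noise `N`
has independent centered Gaussian coordinates with variance `1/r_i`, and `‖w‖₁ ≤ B_W`.
Then: (a) `Σ w_i²/r_i² ≤ 4dB_W²/R²`; (b) `𝔼⟨w,N⟩² = Σ w_i²/r_i ≤ 2B_W²/R`;
(c) `𝔼‖N‖² = Σ 1/r_i ≤ 2d²/R`; (d) `𝔼[⟨w,N⟩²‖N‖²] ≤ 12(d/R²)B_W² + 4(d²/R²)B_W²`. -/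
theorem moment_bounds_efficient_allocation
    {Ω : Type*} [MeasurableSpace Ω] (μ : Measure Ω) [IsProbabilityMeasure μ]
    (d : ℕ) (hd : 1 ≤ d) (R BW : ℝ) (hR : 0 < R) (hBW : 0 ≤ BW)
    (w : Fin d → ℝ) (hw : w ≠ 0) (hw1 : ∑ i, |w i| ≤ BW)
    (r : Fin d → ℝ)
    (hr1 : ∀ i, R / (2 * d) ≤ r i)
    (hr2 : ∀ i, R * |w i| / (2 * ∑ j, |w j|) ≤ r i)
    (N : Ω → Fin d → ℝ) (hNmeas : Measurable N)
    (hindep : iIndepFun (m := fun _ => (inferInstance : MeasurableSpace ℝ))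
      (fun i ω => N ω i) μ)
    (hgauss : ∀ i, Measure.map (fun ω => N ω i) μ =
      gaussianReal 0 (Real.toNNReal (1 / r i))) :
    (∑ i, (w i) ^ 2 / (r i) ^ 2 ≤ 4 * (d : ℝ) * BW ^ 2 / R ^ 2) ∧
      ((∫ ω, (∑ i, w i * N ω i) ^ 2 ∂μ = ∑ i, (w i) ^ 2 / r i) ∧
        ∑ i, (w i) ^ 2 / r i ≤ 2 * BW ^ 2 / R) ∧
      ((∫ ω, (∑ i, (N ω i) ^ 2) ∂μ = ∑ i, 1 / r i) ∧
        ∑ i, 1 / r i ≤ 2 * (d : ℝ) ^ 2 / R) ∧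
      (∫ ω, (∑ i, w i * N ω i) ^ 2 * (∑ i, (N ω i) ^ 2) ∂μ ≤
        12 * ((d : ℝ) / R ^ 2) * BW ^ 2 + 4 * ((d : ℝ) ^ 2 / R ^ 2) * BW ^ 2) := by
  have hd0 : (0 : ℝ) < d := by exact_mod_cast hd
  have hr (i) : 0 < r i := lt_of_lt_of_le (by positivity) (hr1 i)
  have hv (i) : ((Real.toNNReal (1 / r i) : NNReal) : ℝ) = 1 / r i :=
    Real.coe_toNNReal _ (by have := hr i; positivity)
  have hNi (i) : Measurable fun ω ↦ N ω i := (measurable_pi_apply i).comp hNmeas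
  obtain ⟨k, hk⟩ := Function.ne_iff.1 hw
  have hW : 0 < ∑ j, |w j| :=
    Finset.sum_pos' (fun i _ ↦ abs_nonneg _) ⟨k, Finset.mem_univ k, abs_pos.2 hk⟩
  have hratio (i) : |w i| / r i ≤ 2 * BW / R := by
    have h := hr2 i
    rw [div_le_iff₀ (by positivity)] at h
    rw [div_le_div_iff₀ (hr i) hR]
    nlinarith [mul_le_mul_of_nonneg_left hw1 (hr i).le]
  have ha : ∑ i, (w i) ^ 2 / (r i) ^ 2 ≤ 4 * (d : ℝ) * BW ^ 2 / R ^ 2 := by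
    calc ∑ i, (w i) ^ 2 / (r i) ^ 2
      _ ≤ ∑ _i : Fin d, (2 * BW / R) ^ 2 := Finset.sum_le_sum fun i _ ↦ by
        rw [← sq_abs (w i), ← div_pow]
        exact pow_le_pow_left₀ (div_nonneg (abs_nonneg _) (hr i).le) (hratio i) 2
      _ = 4 * (d : ℝ) * BW ^ 2 / R ^ 2 := by
        simp
        ring
  have hb : ∑ i, (w i) ^ 2 / r i ≤ 2 * BW ^ 2 / R := by
    calc ∑ i, (w i) ^ 2 / r i
      _ ≤ ∑ i, |w i| * (2 * BW / R) := Finset.sum_le_sum fun i _ ↦ by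
        rw [← sq_abs (w i), sq, mul_div_assoc]
        exact mul_le_mul_of_nonneg_left (hratio i) (abs_nonneg _)
      _ ≤ BW * (2 * BW / R) := by
        rw [← Finset.sum_mul]
        exact mul_le_mul_of_nonneg_right hw1 (by positivity)
      _ = 2 * BW ^ 2 / R := by ring
  have hc : ∑ i, 1 / r i ≤ 2 * (d : ℝ) ^ 2 / R := by
    calc ∑ i, 1 / r i
      _ ≤ ∑ _i : Fin d, 1 / (R / (2 * d)) := Finset.sum_le_sum fun i _ ↦
        one_div_le_one_div_of_le (by positivity) (hr1 i)
      _ = 2 * (d : ℝ) ^ 2 / R := by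
        simp
        ring
  refine ⟨ha, ⟨?_, hb⟩, ⟨?_, hc⟩, ?_⟩
  · rw [integral_sum_mul_gaussian_sq hNi hindep hgauss w Finset.univ]
    simp only [hv, mul_one_div]
  · rw [integral_sum_gaussian_sq hNi hgauss]
    simp only [hv]
  · rw [integral_sum_mul_gaussian_sq_mul_sum_sq hNi hindep hgauss w]
    simp only [hv, mul_one_div, one_div_pow]
    have hprod := mul_le_mul hb hc
      (Finset.sum_nonneg fun i _ ↦ (one_div_pos.2 (hr i)).le) (by positivity)
    have hslack : 0 ≤ (d : ℝ) * BW ^ 2 / R ^ 2 := by positivity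
    calc _ ≤ 2 * (4 * (d : ℝ) * BW ^ 2 / R ^ 2) + 2 * BW ^ 2 / R * (2 * (d : ℝ) ^ 2 / R) := by
          linarith
      _ = 8 * ((d : ℝ) * BW ^ 2 / R ^ 2) + 4 * ((d : ℝ) ^ 2 / R ^ 2) * BW ^ 2 := by ring
      _ ≤ 12 * ((d : ℝ) * BW ^ 2 / R ^ 2) + 4 * ((d : ℝ) ^ 2 / R ^ 2) * BW ^ 2 := by linarith
      _ = _ := by ring
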